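/- Let ℒ and ℒ' be distributive abstract logics and let h : ℒ → ℒ' be a logic map. Then h is stable if and only if for all a, b ∈ Expr, h(a ∨ b) is logically equivalent in ℒ' to h(a) ∨' h(b), where ∨ and ∨' are the respective disjunctions of ℒ and ℒ'. -/

import Mathlib

/-- An abstract logic: a nonempty family of theories on `Expr`
closed under intersections of nonempty subfamilies. -/
def IsAbstractLogic {Expr : Type*} (Th : Set (Set Expr)) : Prop :=
  Th.Nonempty ∧ ∀ 𝒯 ⊆ Th, 𝒯.Nonempty → ⋂₀ 𝒯 ∈ Th

/-- The logic is closed under chains: the union of every nonempty chain of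
theories is a theory. -/
def ChainClosed {Expr : Type*} (Th : Set (Set Expr)) : Prop :=
  ∀ 𝒯 ⊆ Th, 𝒯.Nonempty → IsChain (· ⊆ ·) 𝒯 → ⋃₀ 𝒯 ∈ Th

/-- A theory is totally prime if whenever it is the intersection of a nonempty
family of theories, it belongs to that family. -/
def TotallyPrimeTheory {Expr : Type*} (Th : Set (Set Expr)) (T : Set Expr) : Prop :=
  T ∈ Th ∧ ∀ 𝒯 ⊆ Th, 𝒯.Nonempty → T = ⋂₀ 𝒯 → T ∈ 𝒯

/-- A theory is prime if whenever it is the intersection of two theories,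
it equals one of them. -/
def PrimeTheory {Expr : Type*} (Th : Set (Set Expr)) (T : Set Expr) : Prop :=
  T ∈ Th ∧ ∀ T₁ ∈ Th, ∀ T₂ ∈ Th, T = T₁ ∩ T₂ → T = T₁ ∨ T = T₂

/-- A distributive abstract logic: an abstract logic closed under chains with
binary operations `vee` (disjunction) and `wedge` (conjunction) behaving as
expected on all totally prime theories. -/
def IsDistributiveLogic {Expr : Type*} (Th : Set (Set Expr))
    (vee wedge : Expr → Expr → Expr) : Prop :=
  IsAbstractLogic Th ∧ ChainClosed Th ∧
  (∀ T, TotallyPrimeTheory Th T → ∀ a b, vee a b ∈ T ↔ (a ∈ T ∨ b ∈ T)) ∧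
  (∀ T, TotallyPrimeTheory Th T → ∀ a b, wedge a b ∈ T ↔ (a ∈ T ∧ b ∈ T))

/-- Logical equivalence: two expressions belong to exactly the same theories. -/
def LogEquiv {Expr : Type*} (Th : Set (Set Expr)) (a b : Expr) : Prop :=
  ∀ T ∈ Th, (a ∈ T ↔ b ∈ T)

theorem TotallyPrimeTheory.primeTheory {Expr : Type*} {Th : Set (Set Expr)} {T : Set Expr}
    (hT : TotallyPrimeTheory Th T) : PrimeTheory Th T := by
  refine ⟨hT.1, fun T₁ h₁ T₂ h₂ h => ?_⟩
  have hmem := hT.2 {T₁, T₂} (Set.pair_subset h₁ h₂) (Set.insert_nonempty _ _)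
    (by rw [Set.sInter_pair, h])
  simpa using hmem

/-- In a chain-closed logic, a theory omitting `x` extends to a totally prime theory
omitting `x`. -/
theorem ChainClosed.exists_totallyPrimeTheory {Expr : Type*} {Th : Set (Set Expr)}
    (hC : ChainClosed Th) {T : Set Expr} (hT : T ∈ Th) {x : Expr} (hx : x ∉ T) :
    ∃ P, TotallyPrimeTheory Th P ∧ T ⊆ P ∧ x ∉ P := by
  obtain ⟨P, hTP, hP⟩ := zorn_subset_nonempty {S | S ∈ Th ∧ x ∉ S}
    (fun c hc hchain hne => ⟨⋃₀ c, ⟨hC c (fun s hs => (hc hs).1) hne hchain, by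
      rintro ⟨s, hs, hxs⟩
      exact (hc hs).2 hxs⟩, fun s hs => Set.subset_sUnion_of_mem hs⟩) T ⟨hT, hx⟩
  refine ⟨P, ⟨hP.prop.1, fun 𝒯 h𝒯 _ hEq => ?_⟩, hTP, hP.prop.2⟩
  have hxP : x ∉ ⋂₀ 𝒯 := hEq ▸ hP.prop.2
  simp only [Set.mem_sInter, not_forall] at hxP
  obtain ⟨S, hS, hxS⟩ := hxP
  have hPS : P ⊆ S := hEq ▸ Set.sInter_subset_of_mem hS
  rwa [hPS.antisymm (hP.le_of_ge ⟨h𝒯 hS, hxS⟩ hPS)]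

/-- Membership in a theory of a chain-closed logic is tested on the totally prime theories
above it. -/
theorem ChainClosed.mem_of_forall_totallyPrimeTheory {Expr : Type*} {Th : Set (Set Expr)}
    (hC : ChainClosed Th) {T : Set Expr} (hT : T ∈ Th) {x : Expr}
    (h : ∀ P, TotallyPrimeTheory Th P → T ⊆ P → x ∈ P) : x ∈ T := by
  by_contra hx
  obtain ⟨P, hP, hTP, hxP⟩ := hC.exists_totallyPrimeTheory hT hx
  exact hxP (h P hP hTP)

theorem ChainClosed.logEquiv_of_forall_totallyPrimeTheory {Expr : Type*} {Th : Set (Set Expr)}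
    (hC : ChainClosed Th) {a b : Expr}
    (h : ∀ P, TotallyPrimeTheory Th P → (a ∈ P ↔ b ∈ P)) : LogEquiv Th a b := fun _ hT =>
  ⟨fun ha => hC.mem_of_forall_totallyPrimeTheory hT fun P hP hTP => (h P hP).1 (hTP ha),
    fun hb => hC.mem_of_forall_totallyPrimeTheory hT fun P hP hTP => (h P hP).2 (hTP hb)⟩

theorem IsDistributiveLogic.vee_mem {Expr : Type*} {Th : Set (Set Expr)}
    {vee wedge : Expr → Expr → Expr} (hD : IsDistributiveLogic Th vee wedge)
    {T : Set Expr} (hT : T ∈ Th) {a b : Expr} (hab : a ∈ T ∨ b ∈ T) : vee a b ∈ T :=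
  hD.2.1.mem_of_forall_totallyPrimeTheory hT fun P hP hTP =>
    (hD.2.2.1 P hP a b).2 (hab.imp (@hTP a) (@hTP b))

/-- The prime theories of a distributive logic are the theories that split disjunctions. -/
theorem IsDistributiveLogic.primeTheory_iff {Expr : Type*} {Th : Set (Set Expr)}
    {vee wedge : Expr → Expr → Expr} (hD : IsDistributiveLogic Th vee wedge) {T : Set Expr} :
    PrimeTheory Th T ↔ T ∈ Th ∧ ∀ a b, vee a b ∈ T ↔ (a ∈ T ∨ b ∈ T) := by
  constructor
  · refine fun hT => ⟨hT.1, fun a b => ⟨fun hab => ?_, hD.vee_mem hT.1⟩⟩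
    have hsplit : ∀ P, TotallyPrimeTheory Th P → T ⊆ P → a ∈ P ∨ b ∈ P :=
      fun P hP hTP => (hD.2.2.1 P hP a b).1 (hTP hab)
    let above (c : Expr) : Set (Set Expr) := {S | S ∈ Th ∧ T ⊆ S ∧ c ∈ S}
    by_cases hA : (above a).Nonempty
    · by_cases hB : (above b).Nonempty
      · have hEq : T = ⋂₀ above a ∩ ⋂₀ above b := by
          refine Set.Subset.antisymm (Set.subset_inter (Set.subset_sInter fun S hS => hS.2.1)
            (Set.subset_sInter fun S hS => hS.2.1)) fun x hx => ?_
          refine hD.2.1.mem_of_forall_totallyPrimeTheory hT.1 fun P hP hTP => ?_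
          rcases hsplit P hP hTP with ha | hb
          · exact hx.1 P ⟨hP.1, hTP, ha⟩
          · exact hx.2 P ⟨hP.1, hTP, hb⟩
        refine (hT.2 _ (hD.1.2 _ (fun S hS => hS.1) hA) _
          (hD.1.2 _ (fun S hS => hS.1) hB) hEq).imp (fun h => ?_) fun h => ?_
        · rw [h]
          exact fun S hS => hS.2.2
        · rw [h]
          exact fun S hS => hS.2.2
      · exact Or.inl <| hD.2.1.mem_of_forall_totallyPrimeTheory hT.1 fun P hP hTP =>
          (hsplit P hP hTP).resolve_right fun hb => hB ⟨P, hP.1, hTP, hb⟩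
    · exact Or.inr <| hD.2.1.mem_of_forall_totallyPrimeTheory hT.1 fun P hP hTP =>
        (hsplit P hP hTP).resolve_left fun ha => hA ⟨P, hP.1, hTP, ha⟩
  · rintro ⟨hT, hsplit⟩
    refine ⟨hT, fun T₁ h₁ T₂ h₂ hEq => ?_⟩
    by_contra! hne
    have hsub₁ : T ⊆ T₁ := hEq ▸ Set.inter_subset_left
    have hsub₂ : T ⊆ T₂ := hEq ▸ Set.inter_subset_right
    obtain ⟨a, ha, haT⟩ := Set.exists_of_ssubset (hsub₁.ssubset_of_ne hne.1)
    obtain ⟨b, hb, hbT⟩ := Set.exists_of_ssubset (hsub₂.ssubset_of_ne hne.2)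
    have hab : vee a b ∈ T := by
      rw [hEq]
      exact ⟨hD.vee_mem h₁ (Or.inl ha), hD.vee_mem h₂ (Or.inr hb)⟩
    exact ((hsplit a b).1 hab).elim haT hbT

/-- A logic map `h` between distributive abstract logics is
stable iff `h(a ∨ b)` is logically equivalent to `h(a) ∨' h(b)` for all
expressions `a, b`. -/
theorem stable_iff_preserves_disjunction {Expr Expr' : Type*}
    (Th : Set (Set Expr)) (Th' : Set (Set Expr'))
    (vee wedge : Expr → Expr → Expr) (vee' wedge' : Expr' → Expr' → Expr')
    (hD : IsDistributiveLogic Th vee wedge)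
    (hD' : IsDistributiveLogic Th' vee' wedge')
    (h : Expr → Expr') (hmap : ∀ T' ∈ Th', h ⁻¹' T' ∈ Th) :
    (∀ P' : Set Expr', PrimeTheory Th' P' → PrimeTheory Th (h ⁻¹' P')) ↔
      ∀ a b : Expr, LogEquiv Th' (h (vee a b)) (vee' (h a) (h b)) := by
  constructor
  · intro hst a b
    refine hD'.2.1.logEquiv_of_forall_totallyPrimeTheory fun P hP => ?_
    rw [hD'.2.2.1 P hP]
    exact (hD.primeTheory_iff.1 (hst P hP.primeTheory)).2 a b
  · intro hpres P hP
    refine hD.primeTheory_iff.2 ⟨hmap P hP.1, fun a b => ?_⟩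
    exact (hpres a b P hP.1).trans ((hD'.primeTheory_iff.1 hP).2 (h a) (h b))
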